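/- Let k be an algebraic closure of F_p and let f(x) ∈ k[x]. Suppose there exists d with p ∤ d such that the coefficient of x^d in f is nonzero, while for every i > 0 the coefficient of x^{d·p^i} in f is zero. Then for every finite subgroup V of the additive group of k, the polynomial L_V(T) − f(x) is irreducible in k[x][T], where L_V(T) = Π_{v ∈ V} (T − v). -/

import Mathlib

open Polynomial

/-- `L_V(T) = Π_{v ∈ V} (T − v)`. -/
noncomputable def LV {k : Type*} [Field k] (V : Finset k) : Polynomial k :=
  ∏ v ∈ V, (X - C v)

/-- `V` is (the underlying finset of) a finite subgroup of the additive group of `k`. -/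
def IsFinAddSubgroup {k : Type*} [Field k] (V : Finset k) : Prop :=
  (0 : k) ∈ V ∧ (∀ a ∈ V, ∀ b ∈ V, a + b ∈ V) ∧ (∀ a ∈ V, -a ∈ V)


section Aux

lemma LV_monic {k : Type*} [Field k] (V : Finset k) : (LV V).Monic :=
  monic_prod_of_monic _ _ fun v _ => monic_X_sub_C v

lemma LV_natDegree {k : Type*} [Field k] (V : Finset k) : (LV V).natDegree = V.card := by
  unfold LV
  rw [natDegree_prod_of_monic _ _ fun v _ => monic_X_sub_C v]
  simp

lemma LV_eval {k : Type*} [Field k] (V : Finset k) (c : k) :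
    (LV V).eval c = ∏ v ∈ V, (c - v) := by
  simp [LV, eval_prod]

lemma LV_eval_zero_iff {k : Type*} [Field k] (V : Finset k) (c : k) :
    (LV V).eval c = 0 ↔ c ∈ V := by
  rw [LV_eval, Finset.prod_eq_zero_iff]
  constructor
  · rintro ⟨v, hv, h⟩
    rwa [sub_eq_zero.1 h]
  · intro h
    exact ⟨c, h, sub_self c⟩

/-- An invariant monic polynomial of the right degree is `L_V` plus a constant. -/
lemma eq_LV_add {k R : Type*} [Field k] [CommRing R] [IsDomain R] (φ : k →+* R)
    (V : Finset k) (h0 : (0 : k) ∈ V) (B : R[X]) (hB : B.Monic) (hdeg : B.natDegree = V.card)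
    (hinv : ∀ v ∈ V, B.eval (φ v) = B.eval 0) :
    B = (LV V).map φ + C (B.eval 0) := by
  classical
  have hpos : 0 < V.card := Finset.card_pos.2 ⟨0, h0⟩
  have hLm : ((LV V).map φ).Monic := (LV_monic V).map φ
  have hLd : ((LV V).map φ).degree = V.card := by
    rw [degree_eq_natDegree hLm.ne_zero, (LV_monic V).natDegree_map, LV_natDegree]
  have hcd : (C (B.eval 0)).degree < ((LV V).map φ).degree := by
    rw [hLd]
    exact lt_of_le_of_lt degree_C_le (by exact_mod_cast hpos)
  have hBd : B.degree = V.card := by rw [degree_eq_natDegree hB.ne_zero, hdeg]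
  refine eq_of_degree_sub_lt_of_eval_finset_eq (V.image φ) ?_ ?_
  · rw [Finset.card_image_of_injective _ φ.injective, ← hBd]
    refine degree_sub_lt_left ?_ hB.ne_zero ?_
    · rw [degree_add_eq_left_of_degree_lt hcd, hLd, hBd]
    · rw [leadingCoeff_add_of_degree_lt' hcd, hLm.leadingCoeff, hB.leadingCoeff]
  · intro x hx
    obtain ⟨v, hv, rfl⟩ := Finset.mem_image.1 hx
    rw [eval_add, eval_C, hinv v hv, eval_map, eval₂_hom, (LV_eval_zero_iff V v).2 hv]
    simp

lemma card_le_of_inv {k R : Type*} [Field k] [CommRing R] [IsDomain R] (φ : k →+* R)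
    (V : Finset k) (B : R[X]) (hdeg : 0 < B.natDegree)
    (hinv : ∀ v ∈ V, B.eval (φ v) = B.eval 0) :
    V.card ≤ B.natDegree := by
  classical
  by_contra hlt
  push Not at hlt
  have h := eq_zero_of_natDegree_lt_card_of_eval_eq_zero' (B - C (B.eval 0)) (V.image φ) ?_ ?_
  · rw [sub_eq_zero] at h
    rw [h, natDegree_C] at hdeg
    exact lt_irrefl _ hdeg
  · intro x hx
    obtain ⟨v, hv, rfl⟩ := Finset.mem_image.1 hx
    simp [hinv v hv]
  · rw [Finset.card_image_of_injective _ φ.injective, natDegree_sub_C]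
    exact hlt

lemma LV_taylor {k : Type*} [Field k] (V : Finset k) (hV : IsFinAddSubgroup V) (c : k) :
    taylor c (LV V) = LV V + C ((LV V).eval c) := by
  have h := eq_LV_add (RingHom.id k) V hV.1 (taylor c (LV V)) ?_ ?_ ?_
  · simpa [taylor_eval] using h
  · rw [Monic, leadingCoeff_taylor]
    exact LV_monic V
  · rw [natDegree_taylor, LV_natDegree]
  · intro v hv
    simp only [RingHom.id_apply, taylor_eval, LV_eval]
    refine Finset.prod_nbij' (fun w => w - v) (fun w => w + v) ?_ ?_ ?_ ?_ ?_
    · intro w hw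
      rw [sub_eq_add_neg]
      exact hV.2.1 _ hw _ (hV.2.2 _ hv)
    · intro w hw
      exact hV.2.1 _ hw _ hv
    · intro w _
      simp
    · intro w _
      simp
    · intro w _
      ring

lemma LV_eval_add {k : Type*} [Field k] (V : Finset k) (hV : IsFinAddSubgroup V) (a b : k) :
    (LV V).eval (a + b) = (LV V).eval a + (LV V).eval b := by
  rw [← taylor_eval, LV_taylor V hV]
  simp

lemma choose_aux (p : ℕ) [Fact p.Prime] (a m : ℕ) :
    (p ^ a * m).choose (p ^ a) ≡ m [MOD p] := by
  induction a with
  | zero => simp [Nat.ModEq.refl]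
  | succ a ih =>
    rw [pow_succ', mul_assoc]
    refine (Choose.choose_modEq_choose_mod_mul_choose_div_nat).trans ?_
    have hp : 0 < p := (Fact.out : p.Prime).pos
    simpa [Nat.mul_div_cancel_left _ hp] using ih

/-- Coefficients of an additive polynomial are supported on powers of `p`. -/
lemma additive_support {k : Type*} [Field k] [Infinite k] (p : ℕ) [Fact p.Prime] [CharP k p]
    (L : k[X]) (hL : ∀ c, taylor c L = L + C (L.eval c)) (h0 : L.coeff 0 = 0)
    (m : ℕ) (hm : L.coeff m ≠ 0) : ∃ i, m = p ^ i := by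
  have hp : p.Prime := Fact.out
  have hm0 : m ≠ 0 := by
    rintro rfl
    exact hm h0
  obtain ⟨a, m', hm', rfl⟩ := Nat.exists_eq_pow_mul_and_not_dvd hm0 p hp.ne_one
  refine ⟨a, ?_⟩
  by_contra hne
  have hm1 : m' ≠ 1 := by
    rintro rfl
    simp at hne
  have hm'0 : m' ≠ 0 := by
    rintro rfl
    simp at hm'
  have hpa : 0 < p ^ a := pow_pos hp.pos a
  have hder : hasseDeriv (p ^ a) L = C (L.coeff (p ^ a)) := by
    apply Polynomial.funext
    intro c
    rw [← taylor_coeff, hL c, coeff_add, coeff_C, if_neg hpa.ne', eval_C, add_zero]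
  obtain ⟨e, rfl⟩ : ∃ e, m' = e + 2 := ⟨m' - 2, by omega⟩
  have hc := congrArg (fun q => coeff q (p ^ a * (e + 1))) hder
  simp only [hasseDeriv_coeff, coeff_C] at hc
  rw [if_neg (by positivity)] at hc
  rw [show p ^ a * (e + 1) + p ^ a = p ^ a * (e + 2) by ring] at hc
  rcases mul_eq_zero.1 hc with h | h
  · rw [CharP.cast_eq_zero_iff k p] at h
    exact hm' (((choose_aux p a (e + 2)).dvd_iff dvd_rfl).1 h)
  · exact hm h

lemma coeff_pow_char {k : Type*} [Field k] (p : ℕ) [Fact p.Prime] [CharP k p] (h : k[X])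
    (i m : ℕ) : (h ^ p ^ i).coeff m = if p ^ i ∣ m then (h.coeff (m / p ^ i)) ^ p ^ i else 0 := by
  have hp : p.Prime := Fact.out
  rw [← map_iterateFrobenius_expand p, coeff_map, coeff_expand (pow_pos hp.pos i)]
  split_ifs with hd
  · rw [iterateFrobenius_def]
  · simp

lemma key_coeff {k : Type*} [Field k] (p : ℕ) [Fact p.Prime] [CharP k p]
    (L : k[X]) (hL : ∀ m, L.coeff m ≠ 0 → ∃ i, m = p ^ i) (hdeg : 1 < L.natDegree)
    (h : k[X]) (d : ℕ) (hd : ¬ p ∣ d) (h1 : (L.eval₂ C h).coeff d ≠ 0)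
    (h2 : ∀ i, 0 < i → (L.eval₂ C h).coeff (d * p ^ i) = 0) : False := by
  have hp : p.Prime := Fact.out
  have hd0 : 0 < d := by
    rcases Nat.eq_zero_or_pos d with rfl | h
    · simp at hd
    · exact h
  have hL0 : L ≠ 0 := by
    rintro rfl
    simp at hdeg
  have hco : ∀ m, (L.eval₂ C h).coeff m = ∑ j ∈ L.support, L.coeff j * (h ^ j).coeff m := by
    intro m
    rw [eval₂_def, sum_def, finsetSum_coeff]
    simp only [coeff_C_mul]
  have hlead : L.coeff L.natDegree ≠ 0 := by
    rw [coeff_natDegree]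
    exact leadingCoeff_ne_zero.2 hL0
  obtain ⟨n, hn⟩ := hL _ hlead
  have hn0 : 0 < n := by
    rcases Nat.eq_zero_or_pos n with rfl | h
    · simp [hn] at hdeg
    · exact h
  have hhd : h.coeff d ≠ 0 := by
    intro hz
    apply h1
    rw [hco]
    refine Finset.sum_eq_zero fun j hj => ?_
    obtain ⟨i, rfl⟩ := hL j (mem_support_iff.1 hj)
    rw [coeff_pow_char p]
    rcases Nat.eq_zero_or_pos i with rfl | hi
    · simp [hz]
    · rw [if_neg, mul_zero]
      intro hdv
      exact hd ((dvd_pow_self p hi.ne').trans hdv)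
  classical
  obtain ⟨N, hN1, hN2⟩ : ∃ N, h.coeff (d * p ^ N) ≠ 0 ∧ ∀ M, N < M → h.coeff (d * p ^ M) = 0 := by
    refine ⟨Nat.findGreatest (fun N => h.coeff (d * p ^ N) ≠ 0) h.natDegree, ?_, ?_⟩
    · exact Nat.findGreatest_spec (P := fun N => h.coeff (d * p ^ N) ≠ 0) (Nat.zero_le _)
        (by simpa using hhd)
    · intro M hM
      by_cases hle : M ≤ h.natDegree
      · by_contra hne
        exact Nat.findGreatest_is_greatest hM hle hne
      · apply coeff_eq_zero_of_natDegree_lt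
        have : M < p ^ M := Nat.lt_pow_self hp.one_lt
        have : p ^ M ≤ d * p ^ M := Nat.le_mul_of_pos_left _ hd0
        omega
  have hz := h2 (N + n) (by omega)
  rw [hco, Finset.sum_eq_single (p ^ n)] at hz
  · rw [coeff_pow_char p, if_pos (Dvd.intro_left (d * p ^ N) (by ring)),
      show d * p ^ (N + n) = d * p ^ N * p ^ n by ring,
      Nat.mul_div_cancel _ (pow_pos hp.pos n)] at hz
    rw [hn] at hlead
    exact mul_ne_zero hlead (pow_ne_zero _ hN1) hz
  · intro j hj hjn
    obtain ⟨i, rfl⟩ := hL j (mem_support_iff.1 hj)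
    have hle := le_natDegree_of_mem_supp _ hj
    rw [hn] at hle
    have hin : i < n := by
      have h3 := (Nat.pow_le_pow_iff_right hp.one_lt).1 hle
      rcases h3.lt_or_eq with h4 | h4
      · exact h4
      · exact absurd (by rw [h4]) hjn
    have hs : d * p ^ (N + n) = d * p ^ (N + (n - i)) * p ^ i := by
      rw [mul_assoc, ← pow_add]
      congr 2
      omega
    rw [coeff_pow_char p, hs, if_pos (Dvd.intro_left _ rfl),
      Nat.mul_div_cancel _ (pow_pos hp.pos i), hN2 _ (by omega),
      zero_pow (pow_pos hp.pos i).ne', mul_zero]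
  · intro hns
    rw [← hn] at hns
    exact absurd (mem_support_iff.2 hlead) hns

lemma exists_monic_irred {R : Type*} [CommRing R] [IsDomain R] [WfDvdMonoid R[X]] (F : R[X])
    (hF : F.Monic) (hdeg : 0 < F.natDegree) : ∃ A, A.Monic ∧ Irreducible A ∧ A ∣ F := by
  have hnu : ¬ IsUnit F := by
    intro h
    rw [hF.eq_one_of_isUnit h] at hdeg
    simp at hdeg
  obtain ⟨A, hA, hAF⟩ := WfDvdMonoid.exists_irreducible_factor hnu hF.ne_zero
  obtain ⟨Q, hQ⟩ := hAF
  have hlc : A.leadingCoeff * Q.leadingCoeff = 1 := by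
    rw [← leadingCoeff_mul, ← hQ, hF.leadingCoeff]
  have hu : IsUnit (C Q.leadingCoeff : R[X]) :=
    (IsUnit.of_mul_eq_one _ (by rw [mul_comm]; exact hlc)).map C
  have hassoc : Associated A (A * C Q.leadingCoeff) := ⟨hu.unit, rfl⟩
  refine ⟨A * C Q.leadingCoeff, ?_, hassoc.irreducible hA, ?_⟩
  · rw [Monic, leadingCoeff_mul, leadingCoeff_C, hlc]
  · exact hassoc.symm.dvd.trans ⟨Q, hQ⟩

lemma taylor_dvd_taylor {R : Type*} [CommRing R] (c : R) (A F : R[X]) (h : A ∣ F) :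
    taylor c A ∣ taylor c F := by
  obtain ⟨Q, rfl⟩ := h
  exact ⟨taylor c Q, taylor_mul _ _ _⟩

lemma taylor_prod_id {R : Type*} [CommRing R] (c : R) (S : Finset R[X]) :
    taylor c (∏ s ∈ S, s) = ∏ s ∈ S, taylor c s :=
  map_prod (taylorAlgHom c) _ _

set_option maxHeartbeats 1000000 in
theorem main_irred {k : Type*} [Field k] [Infinite k] (p : ℕ) [Fact p.Prime] [CharP k p]
    (f : k[X]) (d : ℕ) (hd : ¬ p ∣ d) (hcoeff : f.coeff d ≠ 0)
    (hhigh : ∀ i, 0 < i → f.coeff (d * p ^ i) = 0)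
    (V : Finset k) (hV : IsFinAddSubgroup V) :
    Irreducible ((LV V).map (C : k →+* k[X]) - C f) := by
  classical
  set F : k[X][X] := (LV V).map (C : k →+* k[X]) - C f with hFdef
  have hVpos : 0 < V.card := Finset.card_pos.2 ⟨0, hV.1⟩
  have hLm : ((LV V).map (C : k →+* k[X])).Monic := (LV_monic V).map _
  have hLd : ((LV V).map (C : k →+* k[X])).natDegree = V.card := by
    rw [(LV_monic V).natDegree_map, LV_natDegree]
  have hFd : F.natDegree = V.card := by rw [hFdef, natDegree_sub_C, hLd]
  have hFm : F.Monic := by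
    refine hLm.sub_of_left (lt_of_le_of_lt degree_C_le ?_)
    rw [degree_eq_natDegree hLm.ne_zero, hLd]
    exact_mod_cast hVpos
  have hFinv : ∀ v ∈ V, taylor (C v) F = F := by
    intro v hv
    rw [hFdef, map_sub, taylor_C, ← map_taylor, LV_taylor V hV, (LV_eval_zero_iff V v).2 hv]
    simp
  obtain ⟨A, hAm, hAi, hAF⟩ := exists_monic_irred F hFm (by omega)
  have htm : ∀ c : k[X], (taylor c A).Monic := by
    intro c
    rw [Monic, leadingCoeff_taylor]
    exact hAm
  have hti : ∀ c : k[X], Irreducible (taylor c A) := by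
    intro c
    have := (MulEquiv.irreducible_iff (taylorEquiv c)).2 hAi
    exact this
  set τ : k → k[X][X] := fun v => taylor (C v) A with hτ
  set S : Finset k[X][X] := V.image τ with hS
  set W : Finset k := V.filter (fun v => τ v = A) with hW
  have hττ : ∀ a b, taylor (C a) (τ b) = τ (a + b) := by
    intro a b
    simp only [hτ, taylor_taylor, C_add]
  have hτ0 : τ 0 = A := by simp [hτ]
  have hτneg : ∀ a b, τ a = τ b ↔ τ (a - b) = A := by
    intro a b
    rw [← (taylor_injective (C b : k[X])).eq_iff (a := τ (a - b)), hττ]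
    simp [hτ]
  have hWs : IsFinAddSubgroup W := by
    refine ⟨?_, ?_, ?_⟩
    · simp [hW, hV.1, hτ0]
    · intro a ha b hb
      rw [hW, Finset.mem_filter] at ha hb ⊢
      refine ⟨hV.2.1 _ ha.1 _ hb.1, ?_⟩
      rw [← hττ, hb.2]
      exact ha.2
    · intro a ha
      rw [hW, Finset.mem_filter] at ha ⊢
      refine ⟨hV.2.2 _ ha.1, ?_⟩
      rw [← zero_sub, ← hτneg, hτ0, ha.2]
  -- the product of all translates
  set B : k[X][X] := ∏ s ∈ S, s with hB
  have hSm : ∀ s ∈ S, s.Monic := by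
    intro s hs
    obtain ⟨v, _, rfl⟩ := Finset.mem_image.1 hs
    exact htm _
  have hBm : B.Monic := monic_prod_of_monic _ _ hSm
  have hBF : B ∣ F := by
    refine Finset.prod_dvd_of_isRelPrime ?_ ?_
    · intro s hs t ht hst
      obtain ⟨v, _, rfl⟩ := Finset.mem_image.1 (Finset.mem_coe.1 hs)
      obtain ⟨w, _, rfl⟩ := Finset.mem_image.1 (Finset.mem_coe.1 ht)
      refine (hti (C v)).isRelPrime_iff_not_dvd.2 fun hdv => hst ?_
      exact eq_of_monic_of_associated (htm _) (htm _) ((hti _).associated_of_dvd (hti _) hdv)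
    · intro s hs
      obtain ⟨v, hv, rfl⟩ := Finset.mem_image.1 hs
      rw [← hFinv v hv]
      exact taylor_dvd_taylor (C v) A F hAF
  have hBd : B.natDegree = S.card * A.natDegree := by
    rw [hB, natDegree_prod_of_monic _ _ hSm, Finset.sum_const_nat]
    intro s hs
    obtain ⟨v, _, rfl⟩ := Finset.mem_image.1 hs
    exact natDegree_taylor _ _
  have hBinv : ∀ v ∈ V, taylor (C v) B = B := by
    intro v hv
    have h1 : taylor (C v) B = ∏ s ∈ S, taylor (C v) s := taylor_prod_id (C v) S
    rw [h1, hB]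
    refine Finset.prod_nbij' (fun s => taylor (C v) s) (fun s => taylor (C (-v)) s) ?_ ?_ ?_ ?_ ?_
    · intro s hs
      obtain ⟨w, hw, rfl⟩ := Finset.mem_image.1 hs
      rw [hττ]
      exact Finset.mem_image_of_mem _ (hV.2.1 _ hv _ hw)
    · intro s hs
      obtain ⟨w, hw, rfl⟩ := Finset.mem_image.1 hs
      rw [hττ]
      exact Finset.mem_image_of_mem _ (hV.2.1 _ (hV.2.2 _ hv) _ hw)
    · intro s _
      simp [taylor_taylor]
    · intro s _
      simp [taylor_taylor]
    · intro s _
      rfl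
  have hApos : 0 < A.natDegree := by
    rcases Nat.eq_zero_or_pos A.natDegree with h | h
    · exact absurd (hAm.natDegree_eq_zero.1 h) hAi.ne_one
    · exact h
  have hSpos : 0 < S.card := Finset.card_pos.2 ⟨τ 0, Finset.mem_image_of_mem _ hV.1⟩
  have hVB : V.card ≤ B.natDegree := by
    refine card_le_of_inv (C : k →+* k[X]) V B (by rw [hBd]; positivity) ?_
    intro v hv
    conv_rhs => rw [← hBinv v hv]
    rw [taylor_eval, zero_add]
  have hBeq : B = F :=
    eq_of_dvd_of_natDegree_le_of_leadingCoeff hBF (by rw [hFd]; exact hVB)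
      (by rw [hBm.leadingCoeff, hFm.leadingCoeff])
  -- counting
  have hcard : V.card = S.card * W.card := by
    rw [Finset.card_eq_sum_card_image τ V, Finset.sum_const_nat]
    intro s hs
    obtain ⟨v, hv, rfl⟩ := Finset.mem_image.1 hs
    refine Finset.card_nbij' (fun a => a - v) (fun a => a + v) ?_ ?_ ?_ ?_
    · intro a ha
      simp only [Finset.coe_filter, Set.mem_setOf_eq, hW] at ha ⊢
      refine ⟨?_, (hτneg _ _).1 ha.2⟩
      rw [sub_eq_add_neg]
      exact hV.2.1 _ ha.1 _ (hV.2.2 _ hv)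
    · intro a ha
      simp only [Finset.coe_filter, Set.mem_setOf_eq, hW] at ha ⊢
      refine ⟨hV.2.1 _ ha.1 _ hv, (hτneg _ _).2 ?_⟩
      rw [add_sub_cancel_right]
      exact ha.2
    · intro a _
      simp
    · intro a _
      simp
  have hAd : A.natDegree = W.card := by
    have : S.card * A.natDegree = S.card * W.card := by
      rw [← hBd, hBeq, hFd, hcard]
    exact Nat.eq_of_mul_eq_mul_left hSpos this
  have hAeq : A = (LV W).map (C : k →+* k[X]) + C (A.eval 0) := by
    refine eq_LV_add _ W hWs.1 A hAm hAd ?_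
    intro v hv
    have h2 : τ v = A := (Finset.mem_filter.1 hv).2
    conv_rhs => rw [← h2]
    simp only [hτ]
    rw [taylor_eval, zero_add]
  set g : k[X] := A.eval 0 with hg
  by_cases hS1 : S.card = 1
  · obtain ⟨s, hs⟩ := Finset.card_eq_one.1 hS1
    have hsA : A = s := by
      have : τ 0 ∈ S := Finset.mem_image_of_mem _ hV.1
      rw [hs, hτ0] at this
      exact Finset.mem_singleton.1 this
    rw [← hBeq, hB, hs, Finset.prod_singleton, ← hsA]
    exact hAi
  exfalso
  set U : Finset k := V.image (fun v => (LV W).eval v) with hU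
  have hzero : (LV W).eval 0 = 0 := (LV_eval_zero_iff W 0).2 hWs.1
  have hUs : IsFinAddSubgroup U := by
    refine ⟨?_, ?_, ?_⟩
    · exact Finset.mem_image.2 ⟨0, hV.1, hzero⟩
    · intro a ha b hb
      obtain ⟨v, hv, rfl⟩ := Finset.mem_image.1 ha
      obtain ⟨w, hw, rfl⟩ := Finset.mem_image.1 hb
      exact Finset.mem_image.2 ⟨v + w, hV.2.1 _ hv _ hw, LV_eval_add W hWs v w⟩
    · intro a ha
      obtain ⟨v, hv, rfl⟩ := Finset.mem_image.1 ha
      refine Finset.mem_image.2 ⟨-v, hV.2.2 _ hv, ?_⟩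
      have := LV_eval_add W hWs (-v) v
      rw [neg_add_cancel, hzero] at this
      exact eq_neg_of_add_eq_zero_left this.symm
  set ψ : k → k[X][X] := fun u => A + C (C u) with hψ
  have hψinj : Function.Injective ψ := by
    intro a b hab
    exact C_injective (C_injective (add_left_cancel hab))
  have hτψ : ∀ v, τ v = ψ ((LV W).eval v) := by
    intro v
    simp only [hτ, hψ]
    conv_lhs => rw [hAeq]
    conv_rhs => rw [hAeq]
    rw [map_add, taylor_C, ← map_taylor, LV_taylor W hWs, Polynomial.map_add, map_C]
    ring
  have hSU : S = U.image ψ := by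
    rw [hS, hU, Finset.image_image]
    exact Finset.image_congr fun v _ => hτψ v
  have hUcard : U.card = S.card := by
    rw [hSU, Finset.card_image_of_injective _ hψinj]
  have hprod : (LV U).eval₂ C g = -f := by
    have h1 : F.eval 0 = -f := by
      rw [hFdef, eval_sub, eval_C, ← C_0 (R := k), eval_map, eval₂_hom,
        (LV_eval_zero_iff V 0).2 hV.1]
      simp
    rw [← h1, ← hBeq, hB, hSU, Finset.prod_image hψinj.injOn, eval_prod, LV, eval₂_finset_prod]
    refine Finset.prod_nbij' (fun u => -u) (fun u => -u) hUs.2.2 hUs.2.2 ?_ ?_ ?_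
    · intro u _
      simp
    · intro u _
      simp
    · intro u _
      simp [hψ, hg, sub_eq_add_neg]
  refine key_coeff p (LV U) ?_ ?_ g d hd ?_ ?_
  · intro m hm
    refine additive_support p (LV U) (LV_taylor U hUs) ?_ m hm
    rw [coeff_zero_eq_eval_zero]
    exact (LV_eval_zero_iff U 0).2 hUs.1
  · rw [LV_natDegree, hUcard]
    omega
  · rw [hprod, coeff_neg]
    exact neg_ne_zero.2 hcoeff
  · intro i hi
    rw [hprod, coeff_neg, hhigh i hi, neg_zero]

end Aux

theorem stmt_9 (p : ℕ) [Fact p.Prime]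
    (f : Polynomial (AlgebraicClosure (ZMod p))) (d : ℕ)
    (hd : ¬ p ∣ d) (hcoeff : f.coeff d ≠ 0)
    (hhigh : ∀ i, 0 < i → f.coeff (d * p ^ i) = 0)
    (V : Finset (AlgebraicClosure (ZMod p))) (hV : IsFinAddSubgroup V) :
    Irreducible
      ((LV V).map (C : AlgebraicClosure (ZMod p) →+* Polynomial (AlgebraicClosure (ZMod p)))
        - C f) :=
  main_irred p f d hd hcoeff hhigh V hV
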